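/- arXiv:1512.04260 — 3 statements merged into one kernel-verified Lean document; each statement's English description precedes it below -/
import Mathlib

section
/- Let A be a unital C*-algebra with finite type elements F, and suppose a ∈ A is invertible up to (p,q) and invertible up to (p',q') with p, q, p', q' projections in F. Then [p] - [q] = [p'] - [q'] in the group K(F). -/
/-- A projection in a C*-algebra: a self-adjoint idempotent. -/
def IsProjection {A : Type*} [Ring A] [StarRing A] (p : A) : Prop :=
  star p = p ∧ p * p = p

/-- Murray–von Neumann equivalence: `p ∼ q` iff there is `v` with `v v* = p`
and `v* v = q`. -/
def MvNEquiv {A : Type*} [Ring A] [StarRing A] (p q : A) : Prop :=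
  ∃ v : A, v * star v = p ∧ star v * v = q

/-- `(u α)_{α}` (indexed by the directed set `(ι, rel)`) is an approximate unit
for `F` consisting of projections. -/
structure IsApproxUnit {A : Type*} [NormedRing A] [StarRing A] (F : Set A)
    {ι : Type} (rel : ι → ι → Prop) (u : ι → A) : Prop where
  nonempty : Nonempty ι
  directed : ∀ α β : ι, ∃ γ : ι, rel α γ ∧ rel β γ
  proj : ∀ α, IsProjection (u α)
  mem : ∀ α, u α ∈ F
  approx : ∀ f ∈ F, ∀ ε : ℝ, 0 < ε → ∃ α, ∀ β, rel α β → ‖f - u β * f‖ < ε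

/-- `F` is an algebra of finite type elements: a self-adjoint two-sided ideal
with an approximate unit consisting of projections, satisfying the
orthogonalization property (iii). -/
structure IsFiniteType {A : Type*} [NormedRing A] [StarRing A] (F : Set A) : Prop where
  zero_mem : (0 : A) ∈ F
  add_mem : ∀ a ∈ F, ∀ b ∈ F, a + b ∈ F
  mul_mem_left : ∀ (a : A), ∀ b ∈ F, a * b ∈ F
  mul_mem_right : ∀ (a : A), ∀ b ∈ F, b * a ∈ F
  star_mem : ∀ a ∈ F, star a ∈ F
  approx_unit : ∃ (ι : Type) (rel : ι → ι → Prop) (u : ι → A), IsApproxUnit F rel u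
  orth : ∀ p ∈ F, ∀ q ∈ F, IsProjection p → IsProjection q →
    ∃ v : A, v * star v = q ∧ IsProjection (star v * v + p)

/-- `b` is a `(p,q)`-inverse of `a`. -/
def IsPQInv {A : Type*} [Ring A] (a p q b : A) : Prop :=
  b = (1 - p) * b * (1 - q) ∧ (1 - q) * a * (1 - p) * b = 1 - q ∧
    b * ((1 - q) * a * (1 - p)) = 1 - p

/-- `a` is invertible up to `(p,q)`. -/
def InvUpTo {A : Type*} [Ring A] (a p q : A) : Prop := ∃ b, IsPQInv a p q b

/-- Equality `[p] - [q] = [p'] - [q']` in the Grothendieck group `K(F)` of the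
semigroup of Murray–von Neumann classes of projections of `F`: there is a
projection `r ∈ F` such that the direct sum `p ⊕ q' ⊕ r` is Murray–von Neumann
equivalent to `p' ⊕ q ⊕ r` (as diagonal projections in `M₃(A)`). -/
def KDiffEq {A : Type*} [NormedRing A] [StarRing A] (F : Set A)
    (p q p' q' : A) : Prop :=
  ∃ r : A, r ∈ F ∧ IsProjection r ∧
    ∃ V : Matrix (Fin 3) (Fin 3) A,
      V * star V = Matrix.diagonal ![p, q', r] ∧
      star V * V = Matrix.diagonal ![p', q, r]

theorem mvn_of_iso {B : Type*} [CStarAlgebra B] (G E Y Z : B)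
    (hG : star G = G) (hE : star E = E) (hG2 : G * G = G)
    (hYZ : Y * Z = G) (hZY : Z * Y = E) (hGY : G * Y = Y) :
    ∃ V : B, V * star V = G ∧ star V * V = E := by
  letI := CStarAlgebra.spectralOrder B
  letI := CStarAlgebra.spectralOrderedRing B
  have hpos : (0 : B) ≤ Z * star Z := mul_star_self_nonneg Z
  have h1 : star Z * star Y = G := by rw [← star_mul, hYZ, hG]
  have h2 : star Y * star Z = E := by rw [← star_mul, hZY, hE]
  have e1 : (Z * star Z) * (star Y * Y) = E := by
    calc _ = Z * ((star Z * star Y) * Y) := by noncomm_ring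
      _ = E := by rw [h1, hGY, hZY]
  have e2 : (star Y * Y) * (Z * star Z) = E := by
    have := congrArg star e1
    simpa [star_mul, hE, mul_assoc] using this
  have hcomm : Commute (Z * star Z) (star Y * Y) := e1.trans e2.symm
  have hS : CFC.sqrt (Z * star Z) * CFC.sqrt (Z * star Z) = Z * star Z :=
    CFC.sqrt_mul_sqrt_self _ hpos
  have hSs : star (CFC.sqrt (Z * star Z)) = CFC.sqrt (Z * star Z) :=
    (IsSelfAdjoint.of_nonneg (CFC.sqrt_nonneg _))
  have hSc : Commute (CFC.sqrt (Z * star Z)) (star Y * Y) := by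
    rw [CFC.sqrt_eq_cfc]
    exact hcomm.cfc_nnreal _
  set S := CFC.sqrt (Z * star Z)
  refine ⟨Y * S, ?_, ?_⟩
  · rw [star_mul, hSs]
    calc _ = Y * (S * S) * star Y := by noncomm_ring
      _ = (Y * Z) * (star Z * star Y) := by rw [hS]; noncomm_ring
      _ = G := by rw [hYZ, h1, hG2]
  · rw [star_mul, hSs]
    calc _ = S * (star Y * Y) * S := by noncomm_ring
      _ = (star Y * Y) * (S * S) := by rw [hSc.eq]; noncomm_ring
      _ = E := by rw [hS, e2]

theorem schur_iso {B : Type*} [Ring B] (U X E1 G1 E G n K : B)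
    (hUX : U * X = E1) (hXU : X * U = G1)
    (hUG : U * G1 = U) (hEU : E1 * U = U)
    (hE : E1 = E + n) (hG : G1 = G + n)
    (hnE : n * E = 0) (hEn : E * n = 0) (hnG : n * G = 0) (hGn : G * n = 0)
    (hE2 : E * E = E) (hG2 : G * G = G)
    (hnK : n * K = K) (hKn : K * n = K)
    (hK1 : K * U * n = n) (hK2 : n * U * K = n) :
    (U - U * K * U) * (G * X * E) = E ∧ (G * X * E) * (U - U * K * U) = G := by
  have hE' : E = E1 - n := by rw [hE]; abel
  have hG' : G = G1 - n := by rw [hG]; abel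
  have a1 : (U - U * K * U) * n = 0 := by
    calc _ = U * n - U * (K * U * n) := by noncomm_ring
      _ = 0 := by rw [hK1, sub_self]
  have a2 : n * (U - U * K * U) = 0 := by
    calc _ = n * U - (n * U * K) * U := by noncomm_ring
      _ = 0 := by rw [hK2, sub_self]
  have a3 : (U - U * K * U) * G = U - U * K * U := by
    calc _ = (U * G1 - U * K * (U * G1)) - (U - U * K * U) * n := by rw [hG']; noncomm_ring
      _ = _ := by rw [a1, hUG, sub_zero]
  have a4 : E * (U - U * K * U) = U - U * K * U := by
    calc _ = ((E1 * U) - (E1 * U) * K * U) - n * (U - U * K * U) := by rw [hE']; noncomm_ring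
      _ = _ := by rw [a2, hEU, sub_zero]
  have a5 : K * E = 0 := by rw [← hKn, mul_assoc, hnE, mul_zero]
  have a6 : G * K = 0 := by rw [← hnK, ← mul_assoc, hGn, zero_mul]
  have a7 : E1 * E = E := by rw [hE, add_mul, hE2, hnE, add_zero]
  have a8 : G * G1 = G := by rw [hG, mul_add, hG2, hGn, add_zero]
  have a9 : K * E1 = K := by rw [hE, mul_add, a5, zero_add, hKn]
  have a10 : G1 * K = K := by rw [hG, add_mul, a6, zero_add, hnK]
  constructor
  · calc _ = ((U - U * K * U) * G) * X * E := by noncomm_ring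
      _ = (U * X) * E - U * (K * (U * X)) * E := by rw [a3]; noncomm_ring
      _ = E - U * (K * E) := by rw [hUX, a9, a7]; noncomm_ring
      _ = E := by rw [a5]; simp
  · calc _ = G * X * (E * (U - U * K * U)) := by noncomm_ring
      _ = G * (X * U) - G * ((X * U) * K) * U := by rw [a4]; noncomm_ring
      _ = G - (G * K) * U := by rw [hXU, a10, a8]
      _ = G := by rw [a6]; simp

theorem pq_facts {A : Type*} [Ring A] {a p q b : A} (hp : p * p = p) (hq : q * q = q)
    (h : IsPQInv a p q b) :
    p * b = 0 ∧ b * q = 0 ∧ (1 - b * a) * p = 1 - b * a ∧ q * (1 - a * b) = 1 - a * b := by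
  obtain ⟨h1, h2, h3⟩ := h
  have hpb : p * b = 0 := by
    rw [h1]
    calc _ = (p - p * p) * b * (1 - q) := by noncomm_ring
      _ = 0 := by rw [hp]; simp
  have hbq : b * q = 0 := by
    rw [h1]
    calc _ = (1 - p) * b * (q - q * q) := by noncomm_ring
      _ = 0 := by rw [hq]; simp
  refine ⟨hpb, hbq, ?_, ?_⟩
  · have : b * a * (1 - p) = 1 - p := by
      calc _ = b * ((1 - q) * a * (1 - p)) + b * q * a * (1 - p) := by noncomm_ring
        _ = 1 - p := by rw [h3, hbq]; simp
    calc _ = (1 - b * a) - ((1 - p) - b * a * (1 - p)) := by noncomm_ring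
      _ = _ := by rw [this]; simp
  · have : (1 - q) * (a * b) = 1 - q := by
      calc _ = (1 - q) * a * (1 - p) * b + (1 - q) * a * (p * b) := by noncomm_ring
        _ = 1 - q := by rw [h2, hpb]; simp
    calc _ = (1 - a * b) - ((1 - q) - (1 - q) * (a * b)) := by noncomm_ring
      _ = _ := by rw [this]; simp

/-- The explicit isomorphism `(p, q', 1) → (p', q, 1)`. -/
def isoMat {A : Type*} [Ring A] (a b q p' q' : A) : Matrix (Fin 3) (Fin 3) A :=
  !![0, 0, p'; -((1 - a * b) * a), (1 - a * b) * q', (1 - a * b) * a; 1 - b * a, b * q', b * a]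

theorem isoMat_mul {A : Type*} [Ring A] {a p q b p' q' b' : A}
    (hp : p * p = p) (hq : q * q = q) (hp' : p' * p' = p') (hq' : q' * q' = q')
    (h : IsPQInv a p q b) (h' : IsPQInv a p' q' b') :
    isoMat a b q p' q' * isoMat a b' q' p q = Matrix.diagonal ![p', q, 1] := by
  obtain ⟨h1, h2, h3, h4⟩ := pq_facts hp hq h
  obtain ⟨h1', h2', h3', h4'⟩ := pq_facts hp' hq' h'
  have e12 : p' * (1 - b' * a) = p' := by
    rw [mul_sub, ← mul_assoc, h1']; simp
  have e13 : (1 - a * b) * a = a * (1 - b * a) := by noncomm_ring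
  have e14 : (1 - a * b) * a * p = (1 - a * b) * a := by rw [e13, mul_assoc, h3]
  have e15 : (1 - a * b) * q = q := by rw [sub_mul, mul_assoc, h2]; simp
  have f4 : ∀ x, q' * ((1 - a * b') * x) = (1 - a * b') * x := fun x => by
    rw [← mul_assoc, h4']
  ext i j
  fin_cases i <;> fin_cases j <;>
    simp only [isoMat, Matrix.mul_apply, Fin.sum_univ_three, Matrix.diagonal_apply] <;>
    simp
  · exact e12
  · rw [← mul_assoc, h1', zero_mul]
  · rw [← mul_assoc, h1', zero_mul]
  · rw [mul_assoc _ q', f4]; noncomm_ring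
  · rw [mul_assoc _ q', f4]
    calc _ = (1 - a * b) * q := by noncomm_ring
      _ = q := e15
  · rw [mul_assoc _ q', f4, e14]; noncomm_ring
  · rw [mul_assoc _ q', f4]; noncomm_ring
  · rw [mul_assoc _ q', f4]
    calc _ = b * q := by noncomm_ring
      _ = 0 := h2
  · rw [mul_assoc _ q', f4, h3]; noncomm_ring

theorem isoMat_right {A : Type*} [Ring A] {a p q b p' q' : A}
    (hp : p * p = p) (hq : q * q = q) (hq' : q' * q' = q')
    (h : IsPQInv a p q b) :
    isoMat a b q p' q' * Matrix.diagonal ![p, q', 1] = isoMat a b q p' q' := by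
  obtain ⟨h1, h2, h3, h4⟩ := pq_facts hp hq h
  have e13 : (1 - a * b) * a = a * (1 - b * a) := by noncomm_ring
  have e14 : (1 - a * b) * a * p = (1 - a * b) * a := by rw [e13, mul_assoc, h3]
  ext i j
  rw [Matrix.mul_diagonal]
  fin_cases i <;> fin_cases j <;> simp [isoMat, mul_assoc, hq', h3]
  simpa [mul_assoc] using e14

theorem isoMat_left {A : Type*} [Ring A] {a p q b p' q' : A}
    (hp : p * p = p) (hq : q * q = q) (hp' : p' * p' = p')
    (h : IsPQInv a p q b) :
    Matrix.diagonal ![p', q, 1] * isoMat a b q p' q' = isoMat a b q p' q' := by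
  obtain ⟨h1, h2, h3, h4⟩ := pq_facts hp hq h
  ext i j
  rw [Matrix.diagonal_mul]
  fin_cases i <;> fin_cases j <;> simp [isoMat, ← mul_assoc, hp', h4]

theorem mvn_matrix {A : Type*} [CStarAlgebra A] (G E Y Z : Matrix (Fin 3) (Fin 3) A)
    (hG : star G = G) (hE : star E = E) (hG2 : G * G = G)
    (hYZ : Y * Z = G) (hZY : Z * Y = E) (hGY : G * Y = Y) :
    ∃ V : Matrix (Fin 3) (Fin 3) A, V * star V = G ∧ star V * V = E := by
  let _ := CStarAlgebra.spectralOrder A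
  let _ := CStarAlgebra.spectralOrderedRing A
  exact mvn_of_iso (B := CStarMatrix (Fin 3) (Fin 3) A) G E Y Z hG hE hG2 hYZ hZY hGY

/-- Well-definedness of the index: if `a` is invertible both up to `(p,q)` and
up to `(p',q')` with all projections in `F`, then `[p] - [q] = [p'] - [q']`
in `K(F)`. -/
theorem index_well_defined
    {A : Type*} [NormedRing A] [StarRing A] [CStarRing A] [CompleteSpace A]
    [NormedAlgebra ℂ A] [StarModule ℂ A]
    (F : Set A) (hF : IsFiniteType F) (a p q p' q' : A)
    (hpF : p ∈ F) (hqF : q ∈ F) (hp'F : p' ∈ F) (hq'F : q' ∈ F)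
    (hp : IsProjection p) (hq : IsProjection q)
    (hp' : IsProjection p') (hq' : IsProjection q')
    (h : InvUpTo a p q) (h' : InvUpTo a p' q') :
    KDiffEq F p q p' q' := by
  obtain ⟨b, h⟩ := h
  obtain ⟨b', h'⟩ := h'
  obtain ⟨f1, f2, f3, f4⟩ := pq_facts hp.2 hq.2 h
  have hc : 1 - b * a ∈ F := f3 ▸ hF.mul_mem_left _ _ hpF
  obtain ⟨ι, rel, u, hu⟩ := hF.approx_unit
  obtain ⟨α, hα⟩ := hu.approx _ hc 1 one_pos
  obtain ⟨β, hβ, -⟩ := hu.directed α α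
  have hn := hα β hβ
  have hr := hu.proj β
  have hrF := hu.mem β
  generalize u β = r at hn hr hrF
  obtain ⟨hrs, hr2⟩ := hr
  have htu : IsUnit (1 - ((1 - b * a) - r * (1 - b * a))) := isUnit_one_sub_of_norm_lt_one hn
  obtain ⟨s, hts, hst⟩ := isUnit_iff_exists.mp htu
  generalize ht : 1 - ((1 - b * a) - r * (1 - b * a)) = t at hts hst
  have hrt : r * t = r := by
    rw [← ht]
    calc _ = r - (r - r * r) * (1 - b * a) := by noncomm_ring
      _ = r := by rw [hr2]; simp
  have hrs' : r * s = r := by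
    calc r * s = (r * t) * s := by rw [hrt]
      _ = r := by rw [mul_assoc, hts, mul_one]
  have hmt : (1 - r) * (b * a) = t - r := by
    rw [← ht]; noncomm_ring
  have hrm : r * (1 - r) = 0 := by rw [mul_sub, hr2]; simp
  have hmr : (1 - r) * r = 0 := by rw [sub_mul, hr2]; simp
  have hmm : (1 - r) * (1 - r) = 1 - r := by rw [sub_mul, hrm]; simp
  -- the inverse of the corner
  have k0 : r * (s * (1 - r)) = 0 := by rw [← mul_assoc, hrs', hrm]
  have k1 : (1 - r) * (s * (1 - r)) = s * (1 - r) := by rw [sub_mul, k0]; simp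
  have k2 : s * (1 - r) * (1 - r) = s * (1 - r) := by rw [mul_assoc, hmm]
  have k3 : (1 - r) * (b * a) * (s * (1 - r)) = 1 - r := by
    rw [hmt, sub_mul, k0, ← mul_assoc, hts]; simp
  have k4 : s * (1 - r) * (b * a) * (1 - r) = 1 - r := by
    rw [mul_assoc s, hmt, mul_sub s t r, hst, sub_mul, mul_assoc, hrm]; simp
  have hsch := schur_iso (isoMat a b q p' q') (isoMat a b' q' p q)
    (Matrix.diagonal ![p', q, 1]) (Matrix.diagonal ![p, q', 1])
    (Matrix.diagonal ![p', q, r]) (Matrix.diagonal ![p, q', r])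
    (Matrix.diagonal ![0, 0, 1 - r]) (Matrix.diagonal ![0, 0, s * (1 - r)])
    (isoMat_mul hp.2 hq.2 hp'.2 hq'.2 h h') (isoMat_mul hp'.2 hq'.2 hp.2 hq.2 h' h)
    (isoMat_right hp.2 hq.2 hq'.2 h) (isoMat_left hp.2 hq.2 hp'.2 h)
    (by rw [Matrix.diagonal_add]; congr 1; ext i; fin_cases i <;> simp)
    (by rw [Matrix.diagonal_add]; congr 1; ext i; fin_cases i <;> simp)
    (by rw [Matrix.diagonal_mul_diagonal, ← Matrix.diagonal_zero]; congr 1; ext i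
        fin_cases i <;> simp [hmr])
    (by rw [Matrix.diagonal_mul_diagonal, ← Matrix.diagonal_zero]; congr 1; ext i
        fin_cases i <;> simp [hrm])
    (by rw [Matrix.diagonal_mul_diagonal, ← Matrix.diagonal_zero]; congr 1; ext i
        fin_cases i <;> simp [hmr])
    (by rw [Matrix.diagonal_mul_diagonal, ← Matrix.diagonal_zero]; congr 1; ext i
        fin_cases i <;> simp [hrm])
    (by rw [Matrix.diagonal_mul_diagonal]; congr 1; ext i
        fin_cases i <;> simp [hp'.2, hq.2, hr2])
    (by rw [Matrix.diagonal_mul_diagonal]; congr 1; ext i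
        fin_cases i <;> simp [hp.2, hq'.2, hr2])
    (by rw [Matrix.diagonal_mul_diagonal]; congr 1; ext i
        fin_cases i <;> simp [k1])
    (by rw [Matrix.diagonal_mul_diagonal]; congr 1; ext i
        fin_cases i <;> simp [k2])
    (by ext i j
        rw [Matrix.mul_diagonal, Matrix.diagonal_mul]
        fin_cases i <;> fin_cases j <;> simp [isoMat]
        exact k4)
    (by ext i j
        rw [Matrix.mul_diagonal, Matrix.diagonal_mul]
        fin_cases i <;> fin_cases j <;> simp [isoMat]
        exact k3)
  have hG2 : Matrix.diagonal ![p, q', r] * Matrix.diagonal ![p, q', r]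
      = Matrix.diagonal ![p, q', r] := by
    rw [Matrix.diagonal_mul_diagonal]; congr 1; ext i
    fin_cases i <;> simp [hp.2, hq'.2, hr2]
  letI : CStarAlgebra A := {}
  refine ⟨r, hrF, ⟨hrs, hr2⟩, ?_⟩
  refine mvn_matrix _ _ _ _ ?_ ?_ hG2 hsch.2 hsch.1 ?_
  · rw [Matrix.star_eq_conjTranspose, Matrix.diagonal_conjTranspose]; congr 1; ext i
    fin_cases i <;> simp [hp.1, hq'.1, hrs]
  · rw [Matrix.star_eq_conjTranspose, Matrix.diagonal_conjTranspose]; congr 1; ext i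
    fin_cases i <;> simp [hp'.1, hq.1, hrs]
  · rw [← mul_assoc, ← mul_assoc, hG2]
end

section
/- Let A be a unital C*-algebra with finite type elements F, let a be of Fredholm type (invertible up to some pair of projections in F), and let f ∈ F. Then a + f is of Fredholm type and ind(a+f) = ind(a). -/
/-- The quotient by the ideal `F`. -/
theorem exists_quot.{u} {A : Type u} [NormedRing A] [StarRing A] {F : Set A} (hF : IsFiniteType F) :
    ∃ (B : Type u) (_ : Ring B) (π : A →+* B), ∀ x, x ∈ F ↔ π x = 0 := by
  let I : TwoSidedIdeal A := TwoSidedIdeal.mk' F hF.zero_mem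
    (fun {x y} hx hy => hF.add_mem x hx y hy)
    (fun {x} hx => by simpa using hF.mul_mem_left (-1) x hx)
    (fun {x y} hy => hF.mul_mem_left x y hy)
    (fun {x y} hx => hF.mul_mem_right y x hx)
  refine ⟨I.ringCon.Quotient, inferInstance, I.ringCon.mk', fun x => ?_⟩
  have h1 : x ∈ I ↔ x ∈ F := TwoSidedIdeal.mem_mk' _ _ _ _ _ _ _
  rw [← h1, ← TwoSidedIdeal.mem_ker, TwoSidedIdeal.ker_ringCon_mk']

theorem polar_equiv {R : Type*} [CStarAlgebra R] {e f x y : R}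
    (he : star e = e) (hf : star f = f)
    (hxy : x * y = e) (hyx : y * x = f) (hxf : x * f = x) (hfy : f * y = y) :
    ∃ v : R, v * star v = e ∧ star v * v = f := by
  let _ := CStarAlgebra.spectralOrder R
  have := CStarAlgebra.spectralOrderedRing R
  have hff : f * f = f := by rw [← hyx, mul_assoc, ← mul_assoc x, hxy, ← hxy, mul_assoc, hyx, hxf, hyx]
  have hee : e * e = e := by
    rw [← hxy, mul_assoc, ← mul_assoc y, hyx, hfy]
  have hsx : star x * star y = f := by rw [← star_mul, hyx, hf]
  have hsy : star y * star x = e := by rw [← star_mul, hxy, he]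
  have hfx : f * star x = star x := by
    have := congrArg star hxf; rwa [star_mul, hf] at this
  have hyf : star y * f = star y := by
    have := congrArg star hfy; rwa [star_mul, hf] at this
  have hex : e * x = x := by rw [← hxy, mul_assoc, hyx, hxf]
  have hye : y * e = y := by rw [← hxy, ← mul_assoc, hyx, hfy]
  have hey : e * star y = star y := by
    have := congrArg star hye; rwa [star_mul, he] at this
  have hxe : star x * e = star x := by
    have := congrArg star hex; rwa [star_mul, he] at this
  set g : R := y * star y with hg
  have hg0 : 0 ≤ g := mul_star_self_nonneg y
  have h1 : g * (star x * x) = f := by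
    rw [hg, mul_assoc, ← mul_assoc (star y), hsy, hex, hyx]
  have h2 : (star x * x) * g = f := by
    rw [hg, mul_assoc, ← mul_assoc x, hxy, hey, hsx]
  have hcomm : Commute g (star x * x) := by rw [Commute, SemiconjBy, h1, h2]
  have hk : CFC.sqrt g * CFC.sqrt g = g := CFC.sqrt_mul_sqrt_self g hg0
  have hks : star (CFC.sqrt g) = CFC.sqrt g := (IsSelfAdjoint.of_nonneg (CFC.sqrt_nonneg g)).star_eq
  have hkc : Commute (CFC.sqrt g) (star x * x) := by
    rw [CFC.sqrt_eq_cfc]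
    exact hcomm.cfc_nnreal _
  refine ⟨x * CFC.sqrt g, ?_, ?_⟩
  · rw [star_mul, hks, mul_assoc, ← mul_assoc (CFC.sqrt g), hk, hg, mul_assoc y, hsy, hye, hxy]
  · rw [star_mul, hks, mul_assoc, ← mul_assoc (star x), ← mul_assoc, hkc.eq, mul_assoc, hk, h2]

theorem corner_equiv {R : Type*} [Ring R] {P Q E X Y H K : R}
    (hHK : H * K = 1) (hKH : K * H = 1) (hXY : X * Y = Q) (hYX : Y * X = P)
    (hXP : X * P = X) (hQX : Q * X = X) (hEE : E * E = E) (hPE : P * E = E) (hEP : E * P = E)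
    (hQE : Q * E = E) (hEQ : E * Q = E) (hH : H = 1 + (X - 1) * E) :
    ∃ D D' : R, D * D' = Q - E ∧ D' * D = P - E ∧ (P - E) * D' = D' ∧ D' * (Q - E) = D' := by
  have hPP : P * P = P := by
    conv_lhs => rw [← hYX, mul_assoc, hYX, hXP]
    exact hYX
  have hQQ : Q * Q = Q := by
    conv_lhs => rw [← hXY, ← mul_assoc, hXY, hQX]
    exact hXY
  have hHE : H * E = X * E := by rw [hH, add_mul, mul_assoc, hEE, sub_mul]; simp
  have hQH : Q * H = H * Q := by
    rw [hH, mul_add, add_mul, mul_assoc (X - 1), hEQ, ← mul_assoc, mul_sub, hQX, sub_mul, sub_mul]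
    simp [hQE]
  have hKQ : K * Q = Q * K := by
    calc K * Q = K * (Q * H) * K := by rw [mul_assoc, mul_assoc, hHK, mul_one]
      _ = Q * K := by rw [hQH, ← mul_assoc, hKH, one_mul]
  have hX2E : K * X * E = E := by rw [mul_assoc, ← hHE, ← mul_assoc, hKH, one_mul]
  have hY2E : Y * H * E = E := by rw [mul_assoc, hHE, ← mul_assoc, hYX, hPE]
  have hX2Y2 : (K * X) * (Y * H) = Q := by
    rw [mul_assoc, ← mul_assoc X, hXY, hQH, ← mul_assoc, hKH, one_mul]
  have hY2X2 : (Y * H) * (K * X) = P := by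
    rw [mul_assoc, ← mul_assoc H, hHK, one_mul, hYX]
  have hX2P : (K * X) * P = K * X := by rw [mul_assoc, hXP]
  have hQX2 : Q * (K * X) = K * X := by rw [← mul_assoc, ← hKQ, mul_assoc, hQX]
  generalize K * X = X2 at *
  generalize Y * H = Y2 at *
  have hp : (P - E) * (P - E) = P - E := by
    rw [sub_mul, mul_sub, mul_sub, hPP, hPE, hEP, hEE]; simp
  have hq : (Q - E) * (Q - E) = Q - E := by
    rw [sub_mul, mul_sub, mul_sub, hQQ, hQE, hEQ, hEE]; simp
  have hqE : (Q - E) * E = 0 := by rw [sub_mul, hQE, hEE, sub_self]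
  have hpE : (P - E) * E = 0 := by rw [sub_mul, hPE, hEE, sub_self]
  refine ⟨(Q - E) * X2 * (P - E), (P - E) * Y2 * (Q - E), ?_, ?_, ?_, ?_⟩
  · calc _ = (Q - E) * X2 * ((P - E) * (P - E)) * Y2 * (Q - E) := by simp only [mul_assoc]
      _ = (Q - E) * (X2 * P * Y2 - X2 * E * Y2) * (Q - E) := by
        rw [hp, ← sub_mul, ← mul_sub]; simp only [mul_assoc]
      _ = Q - E := by
        rw [hX2P, hX2E, hX2Y2, mul_sub (Q - E) Q, ← mul_assoc _ E, hqE, zero_mul, sub_zero, sub_mul Q E Q,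
          hQQ, hEQ, hq]
  · calc _ = (P - E) * Y2 * ((Q - E) * (Q - E)) * X2 * (P - E) := by simp only [mul_assoc]
      _ = (P - E) * (Y2 * (Q * X2) - Y2 * E * X2) * (P - E) := by
        rw [hq, mul_assoc Y2 E, ← mul_sub, ← sub_mul]; simp only [mul_assoc]
      _ = P - E := by
        rw [hQX2, hY2E, hY2X2, mul_sub (P - E) P, ← mul_assoc _ E, hpE, zero_mul, sub_zero, sub_mul P E P,
          hPP, hEP, hp]
  · rw [mul_assoc, ← mul_assoc, hp]
  · rw [mul_assoc, hq]

/-- Index invariance, algebraic heart. -/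
theorem matrix_equiv {A : Type*} [Ring A]
    {p q p' q' s a b a' b' : A}
    (pp : p * p = p) (qq : q * q = q) (pp' : p' * p' = p') (qq' : q' * q' = q') (ss : s * s = s)
    (ab : a * b = 1 - q) (ba : b * a = 1 - p) (ap : a * p = 0) (qa : q * a = 0)
    (bq : b * q = 0) (pb : p * b = 0)
    (ab' : a' * b' = 1 - q') (ba' : b' * a' = 1 - p') (ap' : a' * p' = 0) (qa' : q' * a' = 0)
    (bq' : b' * q' = 0) (pb' : p' * b' = 0)
    (hu : IsUnit (1 + (b' * a - 1) * (1 - s))) :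
    ∃ D D' : Matrix (Fin 3) (Fin 3) A,
      D * D' = Matrix.diagonal ![p, q', s] ∧ D' * D = Matrix.diagonal ![p', q, s] ∧
      Matrix.diagonal ![p', q, s] * D' = D' ∧ D' * Matrix.diagonal ![p, q', s] = D' := by
  obtain ⟨⟨c, k, hck, hkc⟩, hc⟩ := hu
  simp only at hc
  have e1 : Matrix.diagonal ![p, q', s] =
      Matrix.diagonal ![p, q', 1] - Matrix.diagonal ![0, 0, 1 - s] := by
    rw [Matrix.diagonal_sub]; congr 1; ext i; fin_cases i <;> simp
  have e2 : Matrix.diagonal ![p', q, s] =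
      Matrix.diagonal ![p', q, 1] - Matrix.diagonal ![0, 0, 1 - s] := by
    rw [Matrix.diagonal_sub]; congr 1; ext i; fin_cases i <;> simp
  have sub1 : ∀ z, q * (a * z) = 0 := fun z => by rw [← mul_assoc, qa, zero_mul]
  have sub2 : ∀ z, q' * (a' * z) = 0 := fun z => by rw [← mul_assoc, qa', zero_mul]
  have sub3 : ∀ z, a * (b * z) = z - q * z := fun z => by rw [← mul_assoc, ab, sub_mul, one_mul]
  have sub4 : ∀ z, a' * (b' * z) = z - q' * z := fun z => by
    rw [← mul_assoc, ab', sub_mul, one_mul]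
  have sub5 : ∀ z, q * (q * z) = q * z := fun z => by rw [← mul_assoc, qq]
  have sub6 : ∀ z, q' * (q' * z) = q' * z := fun z => by rw [← mul_assoc, qq']
  have sub7 : ∀ z, b * (q * z) = 0 := fun z => by rw [← mul_assoc, bq, zero_mul]
  have sub8 : ∀ z, b' * (q' * z) = 0 := fun z => by rw [← mul_assoc, bq', zero_mul]
  have sub9 : ∀ z, p * (b * z) = 0 := fun z => by rw [← mul_assoc, pb, zero_mul]
  have sub10 : ∀ z, p' * (b' * z) = 0 := fun z => by rw [← mul_assoc, pb', zero_mul]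
  have hss : (1 - s) * (1 - s) = 1 - s := by simp [mul_sub, sub_mul, ss]
  rw [e1, e2]
  refine corner_equiv
    (X := !![0, 0, p; 0, q' * q, q' * a; p', b' * q, b' * a])
    (Y := !![0, 0, p'; 0, q * q', q * a'; p, b * q', b * a'])
    (H := !![1, 0, p * (1 - s); 0, 1, q' * a * (1 - s); 0, 0, c])
    (K := !![1, 0, -(p * (1 - s) * k); 0, 1, -(q' * a * (1 - s) * k); 0, 0, k])
    ?_ ?_ ?_ ?_ ?_ ?_ ?_ ?_ ?_ ?_ ?_ ?_
  · ext i j; fin_cases i <;> fin_cases j <;>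
      simp [Matrix.mul_apply, Fin.sum_univ_three, Matrix.one_apply, hck]
  · ext i j; fin_cases i <;> fin_cases j <;>
      simp [Matrix.mul_apply, Fin.sum_univ_three, Matrix.one_apply, mul_assoc, hkc]
  · ext i j; fin_cases i <;> fin_cases j <;>
      simp [Matrix.mul_apply, Fin.sum_univ_three, mul_assoc, mul_sub, *]
  · ext i j; fin_cases i <;> fin_cases j <;>
      simp [Matrix.mul_apply, Fin.sum_univ_three, mul_assoc, mul_sub, *]
  · ext i j; fin_cases i <;> fin_cases j <;>
      simp [mul_assoc, *]
  · ext i j; fin_cases i <;> fin_cases j <;>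
      simp [mul_assoc, *]
  · rw [Matrix.diagonal_mul_diagonal]; congr 1; ext i; fin_cases i <;> simp [hss]
  · rw [Matrix.diagonal_mul_diagonal]; congr 1; ext i; fin_cases i <;> simp
  · rw [Matrix.diagonal_mul_diagonal]; congr 1; ext i; fin_cases i <;> simp
  · rw [Matrix.diagonal_mul_diagonal]; congr 1; ext i; fin_cases i <;> simp
  · rw [Matrix.diagonal_mul_diagonal]; congr 1; ext i; fin_cases i <;> simp
  · ext i j; fin_cases i <;> fin_cases j <;>
      simp [Matrix.one_apply, hc]

theorem IsPQInv.rels {A : Type*} [Ring A] {a p q b : A} (pp : p * p = p) (qq : q * q = q)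
    (h : IsPQInv a p q b) :
    ((1 - q) * a * (1 - p)) * b = 1 - q ∧ b * ((1 - q) * a * (1 - p)) = 1 - p ∧
    ((1 - q) * a * (1 - p)) * p = 0 ∧ q * ((1 - q) * a * (1 - p)) = 0 ∧
    b * q = 0 ∧ p * b = 0 := by
  obtain ⟨h1, h2, h3⟩ := h
  have hp : (1 - p) * p = 0 := by rw [sub_mul, pp]; simp
  have hq : (1 - q) * q = 0 := by rw [sub_mul, qq]; simp
  have hp' : p * (1 - p) = 0 := by rw [mul_sub, pp]; simp
  have hq' : q * (1 - q) = 0 := by rw [mul_sub, qq]; simp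
  refine ⟨h2, h3, ?_, ?_, ?_, ?_⟩
  · rw [mul_assoc, hp, mul_zero]
  · rw [← mul_assoc, ← mul_assoc, hq', zero_mul, zero_mul]
  · rw [h1, mul_assoc, hq, mul_zero]
  · rw [h1, ← mul_assoc, ← mul_assoc, hp', zero_mul, zero_mul]

theorem matrix_polar {A : Type*} [CStarAlgebra A] {e f D D' : Matrix (Fin 3) (Fin 3) A}
    (he : star e = e) (hf : star f = f)
    (hxy : D' * D = e) (hyx : D * D' = f) (hxf : D' * f = D') (hfy : f * D = D) :
    ∃ V : Matrix (Fin 3) (Fin 3) A, V * star V = e ∧ star V * V = f := by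
  let _ := CStarAlgebra.spectralOrder A
  have := CStarAlgebra.spectralOrderedRing A
  exact polar_equiv (R := CStarMatrix (Fin 3) (Fin 3) A) (e := e) (f := f) (x := D') (y := D)
    he hf hxy hyx hxf hfy

theorem exists_small {A : Type*} [NormedRing A] [StarRing A] [CStarRing A]
    {F : Set A} (hF : IsFiniteType F) {g : A} (hg : g ∈ F) :
    ∃ s ∈ F, IsProjection s ∧ ‖g * (1 - s)‖ < 1 := by
  obtain ⟨ι, rel, u, hu⟩ := hF.approx_unit
  obtain ⟨α, hα⟩ := hu.approx (star g) (hF.star_mem g hg) 1 one_pos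
  obtain ⟨γ, hγ, -⟩ := hu.directed α α
  refine ⟨u γ, hu.mem γ, hu.proj γ, ?_⟩
  have := hα γ hγ
  rw [← norm_star, star_mul, star_sub, star_one, (hu.proj γ).1, sub_mul, one_mul]
  exact this

/-- Range projection of an idempotent. -/
theorem exists_range_proj {A : Type*} [CStarAlgebra A] {B : Type*} [Ring B] (π : A →+* B)
    {e : A} (ee : e * e = e) (h1 : π e = 1) (h2 : π (star e) = 1) :
    ∃ r : A, IsProjection r ∧ r * e = e ∧ e * r = r ∧ π r = 1 := by
  let _ := CStarAlgebra.spectralOrder A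
  have := CStarAlgebra.spectralOrderedRing A
  have ee' : star e * star e = star e := by rw [← star_mul, ee]
  have hu : IsUnit (1 + (e - star e) * star (e - star e)) := by
    apply CStarAlgebra.isUnit_of_le 1
    exact le_add_of_nonneg_right (mul_star_self_nonneg _)
  obtain ⟨⟨z, k, hzk, hkz⟩, hz⟩ := hu
  simp only at hz
  have hz' : z = 1 + (e * star e - e - star e + star e * e) := by
    rw [hz, star_sub, star_star, sub_mul, mul_sub, mul_sub, ee, ee']; abel
  have hze : z * e = e * star e * e := by
    rw [hz']; simp only [add_mul, sub_mul, mul_assoc, ee, one_mul]; abel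
  have hez : e * z = e * star e * e := by
    rw [hz']; simp only [mul_add, mul_sub, ← mul_assoc, ee, mul_one]; abel
  have hzs : star z = z := by
    rw [hz]; simp [star_add, star_mul]
  have hks : star k = k := by
    have h3 : z * star k = 1 := by
      have := congrArg star hkz
      rwa [star_mul, star_one, hzs] at this
    calc star k = k * z * star k := by rw [hkz, one_mul]
      _ = k := by rw [mul_assoc, h3, mul_one]
  have hke : k * e = e * k := by
    calc k * e = k * (e * z) * k := by rw [mul_assoc, mul_assoc, hzk, mul_one]
      _ = e * k := by rw [hez, ← hze, ← mul_assoc, hkz, one_mul]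
  have hke' : k * star e = star e * k := by
    have := congrArg star hke
    rw [star_mul, star_mul, hks] at this
    exact this.symm
  have hπz : π z = 1 := by rw [hz']; simp [h1, h2]
  have hπk : π k = 1 := by
    have := congrArg π hzk
    rwa [map_mul, hπz, one_mul, map_one] at this
  have hre : e * star e * k * e = e := by
    rw [mul_assoc, hke, ← mul_assoc, ← hez, mul_assoc e z, ← mul_assoc, mul_assoc, hzk, mul_one]
  refine ⟨e * star e * k, ⟨?_, ?_⟩, hre, ?_, ?_⟩
  · rw [star_mul, star_mul, star_star, hks, ← mul_assoc, hke, mul_assoc, hke', mul_assoc]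
  · calc _ = (e * star e * k * e) * (star e * k) := by simp only [mul_assoc]
      _ = _ := by rw [hre, mul_assoc]
  · rw [← mul_assoc, ← mul_assoc, ee]
  · simp [h1, h2, hπk]

theorem exists_fredholm {A : Type*} [CStarAlgebra A] {F : Set A} (hF : IsFiniteType F)
    {B : Type*} [Ring B] (π : A →+* B) (hπ : ∀ x, x ∈ F ↔ π x = 0) {a b : A}
    (hab : π (a * b) = 1) (hba : π (b * a) = 1) :
    ∃ p q : A, p ∈ F ∧ q ∈ F ∧ IsProjection p ∧ IsProjection q ∧ InvUpTo a p q := by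
  obtain ⟨p, hpF, hp, hn⟩ := exists_small hF (g := 1 - b * a) ((hπ _).2 (by simp [← map_mul, hba]))
  have hu : IsUnit (1 - (1 - b * a) * (1 - p)) := (Units.oneSub _ hn).isUnit
  obtain ⟨⟨c, k, hck, hkc⟩, hc⟩ := hu
  simp only at hc
  have pp : (1 - p) * (1 - p) = 1 - p := by simp [mul_sub, sub_mul, hp.2]
  have hcp : c * (1 - p) = b * a * (1 - p) := by
    rw [hc, sub_mul, mul_assoc, pp, sub_mul]; simp
  have hπp : π p = 0 := (hπ p).1 hpF
  have hπc : π c = 1 := by rw [hc, map_sub, map_mul, map_sub, hba]; simp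
  have hπk : π k = 1 := by
    have := congrArg π hck
    rwa [map_mul, hπc, one_mul, map_one] at this
  set d := (1 - p) * k * b with hd
  have hda : d * a * (1 - p) = 1 - p := by
    calc _ = (1 - p) * (k * (b * a * (1 - p))) := by rw [hd]; simp only [mul_assoc]
      _ = _ := by rw [← hcp, ← mul_assoc k, hkc, one_mul, pp]
  have hpd : (1 - p) * d = d := by rw [hd, ← mul_assoc, ← mul_assoc, pp]
  have hπd : π d = π b := by rw [hd]; simp [hπk, hπp]
  have hπe : π (a * d) = 1 := by rw [map_mul, hπd, ← map_mul, hab]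
  have hea : a * d * (a * (1 - p)) = a * (1 - p) := by
    rw [mul_assoc, ← mul_assoc d, hda]
  have ee : a * d * (a * d) = a * d := by
    calc _ = a * d * (a * (1 - p)) * d := by simp only [mul_assoc, hpd]
      _ = _ := by rw [hea, mul_assoc, hpd]
  have hπe' : π (star (a * d)) = 1 := by
    have h : 1 - a * d ∈ F := (hπ _).2 (by simp only [map_sub, map_one, hπe, sub_self])
    have h' := (hπ _).1 (hF.star_mem _ h)
    rw [star_sub, star_one, map_sub, map_one, sub_eq_zero] at h'
    exact h'.symm
  obtain ⟨r, hr, hre, her, hπr⟩ := exists_range_proj π ee hπe hπe'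
  have hra : r * (a * (1 - p)) = a * (1 - p) := by
    calc _ = r * (a * d) * (a * (1 - p)) := by rw [mul_assoc, hea]
      _ = _ := by rw [hre, hea]
  refine ⟨p, 1 - r, hpF, (hπ _).2 (by simp [hπr]), hp, ⟨by simp [hr.1], ?_⟩, d * r, ?_, ?_, ?_⟩
  · simp [mul_sub, sub_mul, hr.2]
  · rw [sub_sub_cancel, ← mul_assoc, hpd, mul_assoc d r r, hr.2]
  · rw [sub_sub_cancel, mul_assoc r, hra]
    calc _ = a * ((1 - p) * d) * r := by simp only [mul_assoc]
      _ = r := by rw [hpd, her]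
  · rw [sub_sub_cancel, mul_assoc r, hra, mul_assoc, hra, ← mul_assoc, hda]

theorem pq_mod {A : Type*} [Ring A] {B : Type*} [Ring B] (π : A →+* B) {a p q b : A}
    (hp : π p = 0) (hq : π q = 0) (h : IsPQInv a p q b) :
    π a * π b = 1 ∧ π b * π a = 1 := by
  obtain ⟨-, h2, h3⟩ := h
  have h2 := congrArg π h2
  have h3 := congrArg π h3
  simp [hp, hq] at h2 h3
  exact ⟨h2, h3⟩

/-- Perturbation by a finite type element: if `a` is of Fredholm type and
`f ∈ F`, then `a + f` is of Fredholm type and `ind (a+f) = ind a`, i.e. for any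
pairs of projections in `F` witnessing the Fredholm property of `a` and of
`a + f`, the corresponding index differences agree in `K(F)`. -/
theorem fredholm_perturbation
    {A : Type*} [NormedRing A] [StarRing A] [CStarRing A] [CompleteSpace A]
    [NormedAlgebra ℂ A] [StarModule ℂ A]
    (F : Set A) (hF : IsFiniteType F) (a f : A) (hf : f ∈ F)
    (ha : ∃ p q : A, p ∈ F ∧ q ∈ F ∧ IsProjection p ∧ IsProjection q ∧
      InvUpTo a p q) :
    (∃ p' q' : A, p' ∈ F ∧ q' ∈ F ∧ IsProjection p' ∧ IsProjection q' ∧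
      InvUpTo (a + f) p' q') ∧
    ∀ p q p' q' : A, p ∈ F → q ∈ F → p' ∈ F → q' ∈ F →
      IsProjection p → IsProjection q → IsProjection p' → IsProjection q' →
      InvUpTo a p q → InvUpTo (a + f) p' q' →
      KDiffEq F p' q' p q := by
  letI : CStarAlgebra A := {}
  obtain ⟨B, _, π, hπ⟩ := exists_quot hF
  have hπf : π f = 0 := (hπ f).1 hf
  constructor
  · obtain ⟨p, q, hpF, hqF, hp, hq, b, hb⟩ := ha
    obtain ⟨h1, h2⟩ := pq_mod π ((hπ p).1 hpF) ((hπ q).1 hqF) hb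
    exact exists_fredholm hF π hπ (b := b) (by simp [hπf, h1]) (by simp [hπf, h2])
  · rintro p q p' q' hpF hqF hpF' hqF' hp hq hp' hq' ⟨b, hb⟩ ⟨b', hb'⟩
    have hπp := (hπ p).1 hpF
    have hπq := (hπ q).1 hqF
    obtain ⟨-, h2⟩ := pq_mod π ((hπ p').1 hpF') ((hπ q').1 hqF') hb'
    obtain ⟨ab, ba, ap, qa, bq, pb⟩ := hb.rels hp.2 hq.2
    obtain ⟨ab', ba', ap', qa', bq', pb'⟩ := hb'.rels hp'.2 hq'.2
    obtain ⟨s, hsF, hs, hn⟩ := exists_small hF (g := 1 - b' * ((1 - q) * a * (1 - p)))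
      ((hπ _).2 (by
        rw [map_add, hπf, add_zero] at h2
        simp [hπp, hπq, h2]))
    have hu : IsUnit (1 + (b' * ((1 - q) * a * (1 - p)) - 1) * (1 - s)) := by
      have := (Units.oneSub _ hn).isUnit
      rw [Units.val_oneSub] at this
      convert this using 1
      rw [sub_eq_add_neg (1 : A) (_ * (1 - s)), ← neg_mul, neg_sub]
    obtain ⟨D, D', h1, h2, h3, h4⟩ := matrix_equiv hp.2 hq.2 hp'.2 hq'.2 hs.2
      ab ba ap qa bq pb ab' ba' ap' qa' bq' pb' hu
    have hst : ∀ x y z : A, star x = x → star y = y → star z = z →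
        star (Matrix.diagonal ![x, y, z]) = Matrix.diagonal ![x, y, z] := by
      intro x y z hx hy hz
      rw [Matrix.star_eq_conjTranspose, Matrix.diagonal_conjTranspose]
      congr 1; ext i; fin_cases i <;> simp [hx, hy, hz]
    refine ⟨s, hsF, hs, ?_⟩
    refine matrix_polar (D' := D') (D := D * Matrix.diagonal ![p', q, s] )
      (hst _ _ _ hp'.1 hq.1 hs.1) (hst _ _ _ hp.1 hq'.1 hs.1) ?_ ?_ h4 ?_
    · rw [← mul_assoc, h2, Matrix.diagonal_mul_diagonal]
      congr 1; ext i; fin_cases i <;> simp [hp'.2, hq.2, hs.2]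
    · rw [mul_assoc, h3, h1]
    · rw [← h1, mul_assoc, ← mul_assoc D', h2, ← mul_assoc, mul_assoc,
        Matrix.diagonal_mul_diagonal]
      congr 2; ext i; fin_cases i <;> simp [hp'.2, hq.2, hs.2]
end

section
/- Let A be a unital C*-algebra with finite type elements F and f ∈ F. Then there exists a projection p ∈ F such that 1 + f is invertible up to (p,p); in particular, 1 + f is of Fredholm type with ind(1+f) = 0. -/
/-- Algebraically equivalent projections of a C*-algebra are Murray–von Neumann equivalent. -/
theorem aux_polar {B : Type*} [CStarAlgebra B] [PartialOrder B] [StarOrderedRing B]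
    (P Q X Y : B) (hP : IsProjection P) (hQ : IsProjection Q)
    (hXY : X * Y = P) (hYX : Y * X = Q) :
    ∃ V : B, V * star V = P ∧ star V * V = Q := by
  obtain ⟨hPs, hPP⟩ := hP
  obtain ⟨hQs, hQQ⟩ := hQ
  obtain ⟨x, hx⟩ : ∃ x, x = P * X * Q := ⟨_, rfl⟩
  obtain ⟨y, hy⟩ : ∃ y, y = Q * Y * P := ⟨_, rfl⟩
  have hPx : P * x = x := by rw [hx, ← mul_assoc, ← mul_assoc, hPP]
  have hxQ : x * Q = x := by rw [hx, mul_assoc, hQQ]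
  have hQy : Q * y = y := by rw [hy, ← mul_assoc, ← mul_assoc, hQQ]
  have hyP : y * P = y := by rw [hy, mul_assoc, hPP]
  have hxy : x * y = P := by
    calc x * y = P * (X * (Q * Q) * Y) * P := by rw [hx, hy]; noncomm_ring
      _ = P * ((X * Y) * (X * Y)) * P := by rw [hQQ, ← hYX]; noncomm_ring
      _ = P := by rw [hXY]; simp only [hPP]
  have hyx : y * x = Q := by
    calc y * x = Q * (Y * (P * P) * X) * Q := by rw [hx, hy]; noncomm_ring
      _ = Q * ((Y * X) * (Y * X)) * Q := by rw [hPP, ← hXY]; noncomm_ring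
      _ = Q := by rw [hYX]; simp only [hQQ]
  have hsx : star x * P = star x := by
    have := congrArg star hPx; rwa [star_mul, hPs] at this
  have hQsx : Q * star x = star x := by
    have := congrArg star hxQ; rwa [star_mul, hQs] at this
  have hsyQ : star y * Q = star y := by
    have := congrArg star hQy; rwa [star_mul, hQs] at this
  have hsxsy : star x * star y = Q := by rw [← star_mul, hyx, hQs]
  have hsysx : star y * star x = P := by rw [← star_mul, hxy, hPs]
  obtain ⟨D, hD⟩ : ∃ D, D = star x * x + (1 - Q) := ⟨_, rfl⟩
  obtain ⟨E, hE⟩ : ∃ E, E = y * star y + (1 - Q) := ⟨_, rfl⟩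
  have hE0 : 0 ≤ E := by
    have h1 : (1 - Q) = star (1 - Q) * (1 - Q) := by
      rw [star_sub, star_one, hQs]
      rw [sub_mul, mul_sub, mul_sub, hQQ]; simp
    rw [hE, h1]
    exact add_nonneg (mul_star_self_nonneg y) (star_mul_self_nonneg _)
  have hDE : D * E = 1 := by
    have : D * E = star x * (x * y) * star y + (star x * x - star x * (x * Q)) +
        (y - Q * y) * star y + (1 - Q - Q + Q * Q) := by rw [hD, hE]; noncomm_ring
    rw [this, hxy, hsx, hsxsy, hxQ, hQy, hQQ]; simp
  have hED : E * D = 1 := by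
    have : E * D = y * (star y * star x) * x + (y * star y - y * (star y * Q)) +
        (star x - Q * star x) * x + (1 - Q - Q + Q * Q) := by rw [hD, hE]; noncomm_ring
    rw [this, hsysx, hyP, hyx, hsyQ, hQsx, hQQ]; simp
  have hEQ : Commute E Q := by
    have h1 : E * Q = y * (star y * Q) + (Q - Q * Q) := by rw [hE]; noncomm_ring
    have h2 : Q * E = (Q * y) * star y + (Q - Q * Q) := by rw [hE]; noncomm_ring
    rw [commute_iff_eq, h1, h2, hsyQ, hQy]
  have hEDc : Commute E D := by rw [commute_iff_eq, hED, hDE]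
  obtain ⟨R, hR⟩ : ∃ R, R = CFC.sqrt E := ⟨_, rfl⟩
  have hRR : R * R = E := by rw [hR]; exact CFC.sqrt_mul_sqrt_self E hE0
  have hRs : star R = R := by
    rw [hR]; exact (IsSelfAdjoint.of_nonneg (CFC.sqrt_nonneg E)).star_eq
  have hRQ : R * Q = Q * R := by rw [hR]; exact (hEQ.cfcₙ_nnreal _).eq
  have hRD : R * D = D * R := by rw [hR]; exact (hEDc.cfcₙ_nnreal _).eq
  refine ⟨x * R, ?_, ?_⟩
  · rw [star_mul, hRs]
    have : x * R * (R * star x) = x * (R * R) * star x := by noncomm_ring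
    rw [this, hRR, hE]
    have : x * (y * star y + (1 - Q)) * star x =
      (x * y) * (star y * star x) + (x - x * Q) * star x := by noncomm_ring
    rw [this, hxy, hsysx, hxQ, hPP]; simp
  · rw [star_mul, hRs]
    have hxx : star x * x = D * Q := by
      rw [hD]
      have : (star x * x + (1 - Q)) * Q = star x * (x * Q) + (Q - Q * Q) := by noncomm_ring
      rw [this, hxQ, hQQ]; simp
    calc R * star x * (x * R) = R * (star x * x) * R := by noncomm_ring
      _ = (R * D) * (Q * R) := by rw [hxx]; noncomm_ring
      _ = D * (R * R) * Q := by rw [hRD, ← hRQ]; noncomm_ring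
      _ = Q := by rw [hRR, hDE, one_mul]

/-- Close idempotents are similar. -/
theorem aux_near {R : Type*} [NormedRing R] [CompleteSpace R] (e e' : R)
    (he : e * e = e) (he' : e' * e' = e') (hn : ‖e‖ ≤ 1) (hd : ‖e - e'‖ < 1 / 4) :
    ∃ z w : R, z * w = 1 ∧ w * z = 1 ∧ e * z = z * e' := by
  have hlt : ‖e * (e - e') - (e - e') * e'‖ < 1 := by
    have h1 : ‖e'‖ ≤ 1 + 1 / 4 := by
      have : e' = e - (e - e') := by abel
      rw [this]
      exact (norm_sub_le _ _).trans (by linarith)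
    have h2 := norm_mul_le e (e - e')
    have h3 := norm_mul_le (e - e') e'
    have h4 := norm_sub_le (e * (e - e')) ((e - e') * e')
    have h5 : ‖e‖ * ‖e - e'‖ ≤ 1 * (1 / 4) :=
      mul_le_mul hn hd.le (norm_nonneg _) (by norm_num)
    have h6 : ‖e - e'‖ * ‖e'‖ ≤ 1 / 4 * (1 + 1 / 4) :=
      mul_le_mul hd.le h1 (norm_nonneg _) (by norm_num)
    linarith
  obtain ⟨u, hu⟩ := isUnit_one_sub_of_norm_lt_one hlt
  refine ⟨u, (u⁻¹ : Rˣ), u.mul_inv, u.inv_mul, ?_⟩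
  rw [hu]
  simp only [mul_sub, sub_mul, mul_one, one_mul, he, he', ← mul_assoc]
  simp only [mul_assoc, he']
  abel

theorem aux_proj_norm {A : Type*} [NormedRing A] [StarRing A] [CStarRing A] (p : A)
    (hp : IsProjection p) : ‖p‖ ≤ 1 := by
  have h := CStarRing.norm_star_mul_self (x := p)
  rw [hp.1, hp.2] at h
  nlinarith [norm_nonneg p]

theorem aux_proj_compl {A : Type*} [Ring A] [StarRing A] (p : A)
    (hp : IsProjection p) : IsProjection (1 - p) := by
  refine ⟨by rw [star_sub, star_one, hp.1], ?_⟩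
  rw [sub_mul, mul_sub, mul_sub, hp.2]; simp

theorem aux_exists_proj {A : Type*} [NormedRing A] [StarRing A]
    (F : Set A) (hF : IsFiniteType F) (h : A) (hh : h ∈ F) (ε : ℝ) (hε : 0 < ε) :
    ∃ r ∈ F, IsProjection r ∧ ‖(1 - r) * h‖ < ε := by
  obtain ⟨ι, rel, u, hu⟩ := hF.approx_unit
  obtain ⟨α, hα⟩ := hu.approx h hh ε hε
  obtain ⟨γ, hγ, -⟩ := hu.directed α α
  refine ⟨u γ, hu.mem γ, hu.proj γ, ?_⟩
  have := hα γ hγ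
  rwa [sub_mul, one_mul]

theorem aux_part_one {A : Type*} [NormedRing A] [StarRing A] [CStarRing A] [CompleteSpace A]
    (F : Set A) (hF : IsFiniteType F) (f : A) (hf : f ∈ F) :
    ∃ p : A, p ∈ F ∧ IsProjection p ∧ InvUpTo (1 + f) p p := by
  obtain ⟨p, hpF, hp, hlt⟩ := aux_exists_proj F hF f hf 1 one_pos
  refine ⟨p, hpF, hp, ?_⟩
  have hs := aux_proj_compl p hp
  have hsn := aux_proj_norm _ hs
  obtain ⟨s, hsd⟩ : ∃ s, s = 1 - p := ⟨_, rfl⟩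
  rw [← hsd] at hs hsn hlt
  have hss := hs.2
  have hg : ‖-(s * f * s)‖ < 1 := by
    rw [norm_neg]
    have h1 := norm_mul_le (s * f) s
    have h2 : ‖s * f‖ * ‖s‖ ≤ ‖s * f‖ * 1 := mul_le_mul_of_nonneg_left hsn (norm_nonneg _)
    linarith
  obtain ⟨u, hu⟩ := isUnit_one_sub_of_norm_lt_one hg
  rw [sub_neg_eq_add] at hu
  obtain ⟨w, hw⟩ : ∃ w : A, w = (u⁻¹ : Aˣ) := ⟨_, rfl⟩
  have h1 : (1 + s * f * s) * w = 1 := by rw [← hu, hw]; exact u.mul_inv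
  have h2 : w * (1 + s * f * s) = 1 := by rw [← hu, hw]; exact u.inv_mul
  have hc : s * (1 + s * f * s) = s * (1 + f) * s := by
    simp only [mul_add, add_mul, ← mul_assoc, hss, mul_one]
  have hc' : (1 + s * f * s) * s = s * (1 + f) * s := by
    simp only [mul_add, add_mul, mul_assoc, hss, mul_one, one_mul]
  have hsw : s * w = w * s := by
    calc s * w = (w * (1 + s * f * s)) * s * w := by rw [h2, one_mul]
      _ = w * ((1 + s * f * s) * s) * w := by noncomm_ring
      _ = w * s * ((1 + s * f * s) * w) := by rw [hc', ← hc]; noncomm_ring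
      _ = w * s := by rw [h1, mul_one]
  unfold InvUpTo IsPQInv
  rw [← hsd]
  refine ⟨s * w * s, ?_, ?_, ?_⟩
  · simp only [← mul_assoc, hss]
    simp only [mul_assoc, hss]
  · rw [← hc]
    calc s * (1 + s * f * s) * (s * w * s)
        = s * ((1 + s * f * s) * s) * w * s := by noncomm_ring
      _ = s * s * ((1 + s * f * s) * w) * s := by rw [hc', ← hc]; noncomm_ring
      _ = s := by rw [h1]; simp [hss]
  · rw [← hc']
    calc s * w * s * ((1 + s * f * s) * s)
        = s * w * (s * (1 + s * f * s)) * s := by noncomm_ring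
      _ = s * (w * (1 + s * f * s)) * (s * s) := by rw [hc, ← hc']; noncomm_ring
      _ = s := by rw [h2]; simp [hss]

/-- Murray–von Neumann equivalence in `M₃(A)` from algebraic equivalence. -/
theorem aux_polar_matrix {A : Type*} [CStarAlgebra A]
    (P Q X Y : Matrix (Fin 3) (Fin 3) A) (hP : IsProjection P) (hQ : IsProjection Q)
    (hXY : X * Y = P) (hYX : Y * X = Q) :
    ∃ V : Matrix (Fin 3) (Fin 3) A, V * star V = P ∧ star V * V = Q := by
  letI := CStarAlgebra.spectralOrder A
  haveI := CStarAlgebra.spectralOrderedRing A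
  exact aux_polar (B := CStarMatrix (Fin 3) (Fin 3) A) P Q X Y hP hQ hXY hYX

/-- A common projection which nearly fixes four elements of `F`. -/
theorem aux_common {A : Type*} [CStarAlgebra A] (F : Set A) (hF : IsFiniteType F)
    (k₁ k₂ k₃ k₄ : A) (h₁ : k₁ ∈ F) (h₂ : k₂ ∈ F) (h₃ : k₃ ∈ F) (h₄ : k₄ ∈ F)
    (ε : ℝ) (hε : 0 < ε) :
    ∃ r ∈ F, IsProjection r ∧ ‖(1 - r) * k₁‖ < ε ∧ ‖(1 - r) * k₂‖ < ε ∧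
      ‖(1 - r) * k₃‖ < ε ∧ ‖(1 - r) * k₄‖ < ε := by
  letI := CStarAlgebra.spectralOrder A
  haveI := CStarAlgebra.spectralOrderedRing A
  obtain ⟨h, hh⟩ : ∃ h, h = k₁ * star k₁ + k₂ * star k₂ + k₃ * star k₃ + k₄ * star k₄ :=
    ⟨_, rfl⟩
  have hhF : h ∈ F := by
    rw [hh]
    exact hF.add_mem _ (hF.add_mem _ (hF.add_mem _ (hF.mul_mem_right _ _ h₁) _
      (hF.mul_mem_right _ _ h₂)) _ (hF.mul_mem_right _ _ h₃)) _ (hF.mul_mem_right _ _ h₄)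
  obtain ⟨r, hrF, hr, hlt⟩ := aux_exists_proj F hF h hhF (ε ^ 2) (by positivity)
  have hs := aux_proj_compl r hr
  have hsn := aux_proj_norm _ hs
  have key : ∀ k : A, k * star k ≤ h → ‖(1 - r) * k‖ < ε := by
    intro k hk
    have e1 : ((1 - r) * k) * star ((1 - r) * k) = (1 - r) * (k * star k) * star (1 - r) := by
      rw [star_mul]; noncomm_ring
    have e2 : ‖(1 - r) * k‖ * ‖(1 - r) * k‖ = ‖(1 - r) * (k * star k) * star (1 - r)‖ := by
      rw [← CStarRing.norm_self_mul_star, e1]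
    have e3 : ‖(1 - r) * (k * star k) * star (1 - r)‖ ≤ ‖(1 - r) * h * star (1 - r)‖ := by
      refine CStarAlgebra.norm_le_norm_of_nonneg_of_le ?_
        (star_right_conjugate_le_conjugate hk (1 - r))
      rw [← e1]; exact mul_star_self_nonneg _
    have e4 : ‖(1 - r) * h * star (1 - r)‖ ≤ ‖(1 - r) * h‖ * 1 := by
      refine (norm_mul_le _ _).trans (mul_le_mul_of_nonneg_left ?_ (norm_nonneg _))
      rwa [hs.1]
    by_contra hcon
    push Not at hcon
    nlinarith
  have n₁ := mul_star_self_nonneg k₁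
  have n₂ := mul_star_self_nonneg k₂
  have n₃ := mul_star_self_nonneg k₃
  have n₄ := mul_star_self_nonneg k₄
  refine ⟨r, hrF, hr, key _ ?_, key _ ?_, key _ ?_, key _ ?_⟩ <;> rw [hh, ← sub_nonneg]
  · convert add_nonneg (add_nonneg n₂ n₃) n₄ using 1; abel
  · convert add_nonneg (add_nonneg n₁ n₃) n₄ using 1; abel
  · convert add_nonneg (add_nonneg n₁ n₂) n₄ using 1; abel
  · convert add_nonneg (add_nonneg n₁ n₂) n₃ using 1; abel

open scoped Matrix.Norms.Operator in
theorem aux_matrix_norm {A : Type*} [NormedRing A] (a b c : A) (ε : ℝ)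
    (ha : ‖a‖ < ε) (hb : ‖b‖ < ε) (hc : ‖c‖ < 2 * ε) :
    ‖(!![0, 0, a; 0, 0, 0; 0, b, c] : Matrix (Fin 3) (Fin 3) A)‖ ≤ 3 * ε := by
  have hε : 0 < ε := lt_of_le_of_lt (norm_nonneg _) ha
  rw [Matrix.linfty_opNorm_def]
  have h3 : (0 : ℝ) ≤ 3 * ε := by positivity
  rw [← Real.coe_toNNReal _ h3, NNReal.coe_le_coe, Finset.sup_le_iff]
  intro i _
  rw [← NNReal.coe_le_coe, Real.coe_toNNReal _ h3]
  fin_cases i <;> simp [Fin.sum_univ_three] <;> linarith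

open scoped Matrix.Norms.Operator in
theorem aux_alg {A : Type*} [CStarAlgebra A] (F : Set A) (hF : IsFiniteType F)
    (p q b c : A) (hpF : p ∈ F) (hqF : q ∈ F) (hp : IsProjection p) (hq : IsProjection q)
    (hcF : c - 1 ∈ F) (hbc : b * c = 1 - p) (hcb : c * b = 1 - q)
    (hcp : c * p = 0) (hqc : q * c = 0) (hpb : p * b = 0) (hbq : b * q = 0) :
    KDiffEq F p q 0 0 := by
  have hpp := hp.2
  have hqq := hq.2
  obtain ⟨T, hT⟩ : ∃ T : Matrix (Fin 3) (Fin 3) A, T = !![b, 0, p; q, 1 - q, 0; 0, q, c] :=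
    ⟨_, rfl⟩
  obtain ⟨T', hT'⟩ : ∃ T' : Matrix (Fin 3) (Fin 3) A,
    T' = !![c, q, 0; 0, 1 - q, q; p, 0, b] := ⟨_, rfl⟩
  have hone : (1 : Matrix (Fin 3) (Fin 3) A) = !![1, 0, 0; 0, 1, 0; 0, 0, 1] :=
    Matrix.one_fin_three
  have hTT' : T * T' = 1 := by
    rw [hT, hT', hone]
    ext i j
    fin_cases i <;> fin_cases j <;>
      simp [Matrix.mul_apply, Fin.sum_univ_three, mul_sub, sub_mul, *]
  have hT'T : T' * T = 1 := by
    rw [hT, hT', hone]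
    ext i j
    fin_cases i <;> fin_cases j <;>
      simp [Matrix.mul_apply, Fin.sum_univ_three, mul_sub, sub_mul, *]
  obtain ⟨ε, hε, hεT⟩ : ∃ ε : ℝ, 0 < ε ∧ 3 * ε * ‖T'‖ < 1 / 4 := by
    have h0 := norm_nonneg T'
    refine ⟨1 / (12 * (‖T'‖ + 1)), by positivity, ?_⟩
    rw [mul_one_div, div_mul_eq_mul_div, div_lt_div_iff₀ (by positivity) (by norm_num)]
    linarith
  obtain ⟨r, hrF, hr, hrp, hrq, hrc, hrc'⟩ := aux_common F hF p q (c - 1) (star (c - 1))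
    hpF hqF hcF (hF.star_mem _ hcF) ε hε
  have hrr := hr.2
  have hs := aux_proj_compl r hr
  refine ⟨r, hrF, hr, ?_⟩
  obtain ⟨P, hPd⟩ : ∃ P : Matrix (Fin 3) (Fin 3) A, P = Matrix.diagonal ![p, 0, r] := ⟨_, rfl⟩
  obtain ⟨Q, hQd⟩ : ∃ Q : Matrix (Fin 3) (Fin 3) A, Q = Matrix.diagonal ![0, q, r] := ⟨_, rfl⟩
  rw [← hPd, ← hQd]
  have hPproj : IsProjection P := by
    rw [hPd]
    constructor
    · rw [Matrix.star_eq_conjTranspose, Matrix.diagonal_conjTranspose]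
      congr 1
      ext i; fin_cases i <;> simp [hp.1, hr.1]
    · rw [Matrix.diagonal_mul_diagonal]
      congr 1
      ext i; fin_cases i <;> simp [hp.2, hr.2]
  have hQproj : IsProjection Q := by
    rw [hQd]
    constructor
    · rw [Matrix.star_eq_conjTranspose, Matrix.diagonal_conjTranspose]
      congr 1
      ext i; fin_cases i <;> simp [hq.1, hr.1]
    · rw [Matrix.diagonal_mul_diagonal]
      congr 1
      ext i; fin_cases i <;> simp [hq.2, hr.2]
  have hPn : ‖P‖ ≤ 1 := by
    rw [hPd, Matrix.linfty_opNorm_diagonal, pi_norm_le_iff_of_nonneg zero_le_one]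
    intro i
    fin_cases i
    · simpa using aux_proj_norm p hp
    · simp
    · simpa using aux_proj_norm r hr
  have hdiff : P * T - T * Q = !![0, 0, p * (1 - r); 0, 0, 0;
      0, -((1 - r) * q), (c - 1) * (1 - r) - (1 - r) * (c - 1)] := by
    rw [hPd, hQd, hT]
    ext i j
    rw [Matrix.sub_apply, Matrix.diagonal_mul, Matrix.mul_diagonal]
    fin_cases i <;> fin_cases j <;> simp [mul_sub, sub_mul, *]
    abel
  have hsk : ∀ k : A, ‖(1 - r) * star k‖ = ‖k * (1 - r)‖ := by
    intro k
    rw [← norm_star, star_mul, star_star, hs.1]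
  have hdn : ‖P * T - T * Q‖ ≤ 3 * ε := by
    rw [hdiff]
    refine aux_matrix_norm _ _ _ ε ?_ ?_ ?_
    · rw [← hsk, hp.1]; exact hrp
    · rw [norm_neg]; exact hrq
    · rw [hsk] at hrc'
      have := norm_sub_le ((c - 1) * (1 - r)) ((1 - r) * (c - 1))
      linarith
  have hd : ‖P - T * Q * T'‖ < 1 / 4 := by
    have h1 : P - T * Q * T' = (P * T - T * Q) * T' := by
      rw [sub_mul, mul_assoc P, hTT', mul_one]
    rw [h1]
    have h2 := norm_mul_le (P * T - T * Q) T'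
    have h3 := mul_le_mul_of_nonneg_right hdn (norm_nonneg T')
    linarith
  have hidem : (T * Q * T') * (T * Q * T') = T * Q * T' := by
    calc (T * Q * T') * (T * Q * T') = T * Q * (T' * T) * Q * T' := by noncomm_ring
      _ = T * (Q * Q) * T' := by rw [hT'T]; noncomm_ring
      _ = _ := by rw [hQproj.2]
  have hcs : @CompleteSpace (Matrix (Fin 3) (Fin 3) A)
      (Matrix.linftyOpNormedRing (n := Fin 3) (α := A)).toMetricSpace.toUniformSpace :=
    inferInstanceAs (CompleteSpace (Fin 3 → Fin 3 → A))
  obtain ⟨z, w, hzw, hwz, hz⟩ := aux_near P (T * Q * T') hPproj.2 hidem hPn hd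
  refine aux_polar_matrix P Q (P * z * T) (T' * w * P) hPproj hQproj ?_ ?_
  · calc P * z * T * (T' * w * P) = P * z * (T * T') * w * P := by noncomm_ring
      _ = P * (z * w) * P := by rw [hTT']; noncomm_ring
      _ = P := by rw [hzw, mul_one, hPproj.2]
  · calc T' * w * P * (P * z * T) = T' * w * (P * P * z) * T := by noncomm_ring
      _ = T' * (w * z) * T * Q * (T' * T) := by rw [hPproj.2, hz]; noncomm_ring
      _ = (T' * T) * Q := by rw [hwz, hT'T]; simp [hT'T]
      _ = Q := by rw [hT'T, one_mul]

theorem aux_part_two {A : Type*} [CStarAlgebra A] (F : Set A) (hF : IsFiniteType F) (f : A)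
    (hf : f ∈ F) (p q : A) (hpF : p ∈ F) (hqF : q ∈ F) (hp : IsProjection p)
    (hq : IsProjection q) (h : InvUpTo (1 + f) p q) : KDiffEq F p q 0 0 := by
  obtain ⟨b, hb, h1, h2⟩ := h
  have hp1 : p * (1 - p) = 0 := by rw [mul_sub, mul_one, hp.2, sub_self]
  have hp2 : (1 - p) * p = 0 := by rw [sub_mul, one_mul, hp.2, sub_self]
  have hq1 : q * (1 - q) = 0 := by rw [mul_sub, mul_one, hq.2, sub_self]
  have hq2 : (1 - q) * q = 0 := by rw [sub_mul, one_mul, hq.2, sub_self]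
  refine aux_alg F hF p q b ((1 - q) * (1 + f) * (1 - p)) hpF hqF hp hq ?_ h2 h1 ?_ ?_ ?_ ?_
  · have e : (1 - q) * (1 + f) * (1 - p) - 1 =
        (1 - q) * f * (1 - p) + ((-1) * q + (q - 1) * p) := by noncomm_ring
    rw [e]
    exact hF.add_mem _ (hF.mul_mem_right _ _ (hF.mul_mem_left _ _ hf)) _
      (hF.add_mem _ (hF.mul_mem_left _ _ hqF) _ (hF.mul_mem_left _ _ hpF))
  · rw [mul_assoc, hp2, mul_zero]
  · rw [← mul_assoc, ← mul_assoc, hq1, zero_mul, zero_mul]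
  · rw [hb, ← mul_assoc, ← mul_assoc, hp1, zero_mul, zero_mul]
  · rw [hb, mul_assoc, hq2, mul_zero]

/-- For `f ∈ F` there is a projection `p ∈ F` such that `1 + f` is invertible
up to `(p,p)`; in particular `1 + f` is of Fredholm type and `ind (1+f) = 0`,
i.e. for any pair of projections in `F` witnessing the Fredholm property of
`1 + f`, the index difference is `0` in `K(F)`. -/
theorem one_add_finite_is_fredholm
    {A : Type*} [NormedRing A] [StarRing A] [CStarRing A] [CompleteSpace A]
    [NormedAlgebra ℂ A] [StarModule ℂ A]
    (F : Set A) (hF : IsFiniteType F) (f : A) (hf : f ∈ F) :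
    (∃ p : A, p ∈ F ∧ IsProjection p ∧ InvUpTo (1 + f) p p) ∧
    ∀ p q : A, p ∈ F → q ∈ F → IsProjection p → IsProjection q →
      InvUpTo (1 + f) p q → KDiffEq F p q 0 0 := by

  refine ⟨aux_part_one F hF f hf, ?_⟩
  intro p q hpF hqF hp hq h
  letI : CStarAlgebra A := {}
  exact aux_part_two F hF f hf p q hpF hqF hp hq h
end
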